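/- arXiv:2001.10197 — 2 statements merged into one kernel-verified Lean document; each statement's English description precedes it below -/
import Mathlib

section
/- The average game of a (j,k) simple game is a monotone [0,1]-valued TU game: for every (j,k) simple game v, the map ṽ defined by ṽ(S) = (1/(j^n(k−1))) Σ_{x∈J^n} [v((j−1)_S, x_{−S}) − v(0_S, x_{−S})] satisfies ṽ(∅) = 0, ṽ(N) = 1, and 0 ≤ ṽ(S) ≤ ṽ(T) ≤ 1 whenever S ⊆ T ⊆ N. -/
open Finset BigOperators

attribute [local instance] Classical.propDecidable

noncomputable section

variable {n j k : ℕ}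

/-- The top element `j-1` of `Fin j`. -/
def topF (j : ℕ) [NeZero j] : Fin j :=
  ⟨j - 1, Nat.sub_lt (Nat.pos_of_ne_zero (NeZero.ne j)) one_pos⟩

/-- The profile equal to the constant `c` on `S` and to `x` off `S`. -/
def mer (S : Finset (Fin n)) (c : Fin j) (x : Fin n → Fin j) : Fin n → Fin j :=
  fun i => if i ∈ S then c else x i

/-- `(j,k)` simple game: `v 0 = 0`, `v (j-1,…,j-1) = k-1`, monotone. -/
def IsJKGame [NeZero j] [NeZero k] (v : (Fin n → Fin j) → Fin k) : Prop :=
  v (fun _ => 0) = 0 ∧ v (fun _ => topF j) = topF k ∧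
    ∀ x y : Fin n → Fin j, (∀ i, x i ≤ y i) → v x ≤ v y

/-- The `(j,k)` simple game with point-veto `a`. -/
def uA [NeZero j] [NeZero k] (a : Fin n → Fin j) (x : Fin n → Fin j) : Fin k :=
  if ∀ i, a i ≤ x i then topF k else 0

/-- The veto game associated with a set `E` of thresholds. -/
def uE [NeZero j] [NeZero k] (E : Set (Fin n → Fin j)) (x : Fin n → Fin j) : Fin k :=
  if ∃ a ∈ E, ∀ i, a i ≤ x i then topF k else 0

/-- Player `i` is a null player of `v`. -/
def NullPlayer [NeZero j] [NeZero k] (v : (Fin n → Fin j) → Fin k) (i : Fin n) : Prop :=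
  ∀ (x : Fin n → Fin j) (y : Fin j), v x = v (Function.update x i y)

/-- Players `i` and `h` are equivalent in `v`. -/
def EquivPlayers [NeZero j] [NeZero k] (v : (Fin n → Fin j) → Fin k) (i h : Fin n) : Prop :=
  ∀ x : Fin n → Fin j, v x = v (x ∘ Equiv.swap i h)

/-- The average game `ṽ(T) = (1/(jⁿ(k-1))) Σ_x [v((j-1)_T, x_{-T}) - v(0_T, x_{-T})]`. -/
def Cfun [NeZero j] [NeZero k] (v : (Fin n → Fin j) → Fin k) (T : Finset (Fin n)) : ℝ :=
  (1 / ((j : ℝ) ^ n * ((k : ℝ) - 1))) *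
    ∑ x : Fin n → Fin j,
      (((v (mer T (topF j) x)).val : ℝ) - ((v (mer T 0 x)).val : ℝ))

/-- The Shapley-Shubik index for `(j,k)` simple games. -/
def Phi [NeZero j] [NeZero k] (v : (Fin n → Fin j) → Fin k) (i : Fin n) : ℝ :=
  ∑ S ∈ univ.filter (fun S : Finset (Fin n) => i ∈ S),
    ((Nat.factorial (S.card - 1) * Nat.factorial (n - S.card) : ℝ) / (Nat.factorial n : ℝ)) *
      (Cfun v S - Cfun v (S.erase i))

/-- The TU game `v_a(S) = (1/(k-1))[v((j-1)_S, a_{-S}) - v(0_S, a_{-S})]`. -/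
def vAgame [NeZero j] [NeZero k] (v : (Fin n → Fin j) → Fin k) (a : Fin n → Fin j)
    (S : Finset (Fin n)) : ℝ :=
  (1 / ((k : ℝ) - 1)) * (((v (mer S (topF j) a)).val : ℝ) - ((v (mer S 0 a)).val : ℝ))

/-- The parametric power index `Φ^a`. -/
def PhiA [NeZero j] [NeZero k] (v : (Fin n → Fin j) → Fin k) (a : Fin n → Fin j) (i : Fin n) : ℝ :=
  ∑ S ∈ univ.filter (fun S : Finset (Fin n) => i ∈ S),
    ((Nat.factorial (S.card - 1) * Nat.factorial (n - S.card) : ℝ) / (Nat.factorial n : ℝ)) *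
      (vAgame v a S - vAgame v a (S.erase i))

/-- The game `w^C`: value `k-1` iff all members of `C` give full support. -/
def wCgame [NeZero j] [NeZero k] (C : Finset (Fin n)) : (Fin n → Fin j) → Fin k :=
  uA (fun i => if i ∈ C then topF j else 0)

/-- The unanimity TU game `γ_S`. -/
def gammaTU (S T : Finset (Fin n)) : ℝ :=
  if S ⊆ T then 1 else 0

end

theorem mer_mono_aux {n j k : ℕ} [NeZero j] [NeZero k]
    (v : (Fin n → Fin j) → Fin k) (hv : IsJKGame v) (S T : Finset (Fin n)) (hST : S ⊆ T)
    (x : Fin n → Fin j) :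
    (((v (mer S (topF j) x)).val : ℝ) - ((v (mer S 0 x)).val : ℝ)) ≤
      (((v (mer T (topF j) x)).val : ℝ) - ((v (mer T 0 x)).val : ℝ)) := by
  obtain ⟨_, _, hm⟩ := hv
  have h1 : v (mer S (topF j) x) ≤ v (mer T (topF j) x) := by
    apply hm
    intro i
    unfold mer
    by_cases hS : i ∈ S
    · simp [hS, hST hS]
    · by_cases hT : i ∈ T
      · simp only [hS, hT, if_true, if_false]
        have := (x i).isLt
        rw [Fin.le_def]
        simp only [topF]
        omega
      · simp [hS, hT]
  have h2 : v (mer T 0 x) ≤ v (mer S 0 x) := by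
    apply hm
    intro i
    unfold mer
    by_cases hS : i ∈ S
    · simp [hS, hST hS]
    · by_cases hT : i ∈ T
      · simp only [hS, hT, if_true, if_false]
        rw [Fin.le_def]
        simp
      · simp [hS, hT]
  rw [Fin.le_def] at h1 h2
  have h1' : ((v (mer S (topF j) x)).val : ℝ) ≤ ((v (mer T (topF j) x)).val : ℝ) := by
    exact_mod_cast h1
  have h2' : ((v (mer T 0 x)).val : ℝ) ≤ ((v (mer S 0 x)).val : ℝ) := by
    exact_mod_cast h2
  linarith

theorem stmt10 {n j k : ℕ} [NeZero j] [NeZero k] (hj : 2 ≤ j) (hk : 2 ≤ k)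
    (v : (Fin n → Fin j) → Fin k) (hv : IsJKGame v) :
    Cfun v (∅ : Finset (Fin n)) = 0 ∧ Cfun v (univ : Finset (Fin n)) = 1 ∧
      ∀ S T : Finset (Fin n), S ⊆ T →
        0 ≤ Cfun v S ∧ Cfun v S ≤ Cfun v T ∧ Cfun v T ≤ 1 := by
  have hk1 : (0 : ℝ) < (k : ℝ) - 1 := by
    have : (2 : ℝ) ≤ k := by exact_mod_cast hk
    linarith
  have hj0 : (0 : ℝ) < (j : ℝ) ^ n := by
    have : (2 : ℝ) ≤ j := by exact_mod_cast hj
    positivity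
  have mono : ∀ S T : Finset (Fin n), S ⊆ T → Cfun v S ≤ Cfun v T := by
    intro S T hST
    unfold Cfun
    apply mul_le_mul_of_nonneg_left _ (by positivity)
    exact Finset.sum_le_sum fun x _ => mer_mono_aux v hv S T hST x
  have h0 : Cfun v (∅ : Finset (Fin n)) = 0 := by
    have e : ∀ (c : Fin j) (x : Fin n → Fin j), mer ∅ c x = x := by
      intro c x; funext i; simp [mer]
    simp [Cfun, e]
  have h1 : Cfun v (univ : Finset (Fin n)) = 1 := by
    obtain ⟨hz, ht, _⟩ := hv
    have e1 : ∀ x : Fin n → Fin j, mer univ (topF j) x = fun _ => topF j := by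
      intro x; funext i; simp [mer]
    have e2 : ∀ x : Fin n → Fin j, mer univ 0 x = fun _ => 0 := by
      intro x; funext i; simp [mer]
    have e3 : (((topF k).val : ℕ) : ℝ) = (k : ℝ) - 1 := by
      simp only [topF]
      rw [Nat.cast_sub (by omega)]
      simp
    unfold Cfun
    simp only [e1, e2, hz, ht, e3]
    simp only [Fin.val_zero, Nat.cast_zero, sub_zero, Finset.sum_const, Finset.card_univ,
      Fintype.card_pi, Fintype.card_fin, Finset.prod_const, nsmul_eq_mul, Nat.cast_pow]
    field_simp
  refine ⟨h0, h1, fun S T hST => ⟨?_, mono S T hST, ?_⟩⟩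
  · rw [← h0]; exact mono _ _ (Finset.empty_subset S)
  · rw [← h1]; exact mono _ _ (Finset.subset_univ T)
end

section
/- Uniqueness of the Shapley-Shubik index for (j,k) simple games: a power index F on the class of (j,k) simple games with n players satisfies Efficiency (Σ_i F_i(v) = 1), Symmetry (equivalent players get equal values), the Null Player property (null players get 0), and Average Convexity (whenever Σ_t α_t ũ_t = Σ_t β_t ṽ_t as average games for convex weights α, β, then Σ_t α_t F(u_t) = Σ_t β_t F(v_t)) if and only if F = Φ. -/
open Finset BigOperators

attribute [local instance] Classical.propDecidable

section helpers

/-- Moebius inversion (existence) over subsets. -/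
lemma exists_lower {n : ℕ} (f : Finset (Fin n) → ℝ) :
    ∃ m : Finset (Fin n) → ℝ, ∀ T, ∑ R ∈ T.powerset, m R = f T := by
  have key : ∀ N : ℕ, ∃ m : Finset (Fin n) → ℝ,
      ∀ T : Finset (Fin n), T.card < N → ∑ R ∈ T.powerset, m R = f T := by
    intro N
    induction N with
    | zero => exact ⟨fun _ => 0, fun T h => absurd h (by omega)⟩
    | succ N ih =>
      obtain ⟨m, hm⟩ := ih
      refine ⟨fun R => if R.card = N then f R - ∑ Q ∈ R.ssubsets, m Q else m R, ?_⟩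
      intro T hT
      have hsub : ∀ Q ∈ T.ssubsets, (if Q.card = N then f Q - ∑ Q' ∈ Q.ssubsets, m Q' else m Q)
          = m Q := by
        intro Q hQ
        have := Finset.card_lt_card (Finset.mem_ssubsets.1 hQ)
        rw [if_neg (by omega)]
      have hp : ∀ g : Finset (Fin n) → ℝ,
          ∑ R ∈ T.powerset, g R = g T + ∑ R ∈ T.ssubsets, g R := by
        intro g
        rw [Finset.ssubsets, Finset.add_sum_erase _ _ (Finset.mem_powerset_self T)]
      rw [hp, Finset.sum_congr rfl hsub]
      by_cases h : T.card = N
      · rw [if_pos h]; ring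
      · rw [if_neg h, ← hp]
        exact hm T (by omega)
  obtain ⟨m, hm⟩ := key (n + 1)
  refine ⟨m, fun T => hm T ?_⟩
  have := Finset.card_le_univ T
  simp at this
  omega

lemma exists_upper {n : ℕ} (f : Finset (Fin n) → ℝ) :
    ∃ e : Finset (Fin n) → ℝ, ∀ R, ∑ C ∈ univ.filter (fun C => R ⊆ C), e C = f R := by
  obtain ⟨m, hm⟩ := exists_lower (fun T => f Tᶜ)
  refine ⟨fun C => m Cᶜ, fun R => ?_⟩
  have h := hm Rᶜ
  rw [compl_compl] at h
  rw [← h]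
  refine Finset.sum_nbij' (fun C => Cᶜ) (fun C => Cᶜ) ?_ ?_ ?_ ?_ ?_
  · intro C hC
    simp only [Finset.mem_filter, Finset.mem_univ, true_and] at hC
    exact Finset.mem_powerset.2 (Finset.compl_subset_compl.2 hC)
  · intro C hC
    simp only [Finset.mem_filter, Finset.mem_univ, true_and]
    have := Finset.compl_subset_compl.2 (Finset.mem_powerset.1 hC)
    rwa [compl_compl] at this
  · intro C _; simp
  · intro C _; simp
  · intro C _; rfl

lemma topF_val (k : ℕ) [NeZero k] : ((topF k).val : ℝ) = (k : ℝ) - 1 := by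
  have := Nat.pos_of_ne_zero (NeZero.ne k)
  simp only [topF]
  rw [Nat.cast_sub (show 1 ≤ k from this)]; simp

lemma le_topF {j : ℕ} [NeZero j] (y : Fin j) : y ≤ topF j := by
  rw [Fin.le_def]; simp only [topF]; omega

lemma topF_ne_zero {j : ℕ} [NeZero j] (hj : 2 ≤ j) : topF j ≠ 0 := by
  intro h
  have := congrArg Fin.val h
  simp only [topF, Fin.val_zero] at this
  omega

lemma wC_apply {n j k : ℕ} [NeZero j] [NeZero k] (C : Finset (Fin n)) (x : Fin n → Fin j) :
    (wCgame C x : Fin k) = if ∀ i ∈ C, x i = topF j then topF k else 0 := by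
  unfold wCgame uA
  congr 1
  apply propext
  refine forall_congr' fun i => ?_
  by_cases h : i ∈ C
  · simp only [h, if_true, true_imp_iff]
    exact ⟨fun h' => le_antisymm (le_topF _) h', fun h' => h'.ge⟩
  · simp [h]

lemma wC_val {n j k : ℕ} [NeZero j] [NeZero k] (C : Finset (Fin n)) (x : Fin n → Fin j) :
    ((wCgame C x : Fin k).val : ℝ) =
      ((k : ℝ) - 1) * ∏ i : Fin n, (if i ∈ C → x i = topF j then (1 : ℝ) else 0) := by
  rw [wC_apply]
  by_cases h : ∀ i ∈ C, x i = topF j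
  · rw [if_pos h, topF_val, Finset.prod_eq_one, mul_one]
    intro i _
    rw [if_pos (h i)]
  · rw [if_neg h]
    push Not at h
    obtain ⟨i, hi, hx⟩ := h
    rw [Finset.prod_eq_zero (Finset.mem_univ i)]
    · simp
    · rw [if_neg]; exact fun h => hx (h hi)

lemma wC_game {n j k : ℕ} [NeZero j] [NeZero k] (hj : 2 ≤ j) (C : Finset (Fin n))
    (hC : C.Nonempty) : IsJKGame (wCgame C : (Fin n → Fin j) → Fin k) := by
  refine ⟨?_, ?_, ?_⟩
  · rw [wC_apply, if_neg]
    obtain ⟨i, hi⟩ := hC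
    exact fun h => topF_ne_zero hj (h i hi).symm
  · rw [wC_apply, if_pos]; intros; rfl
  · intro x y hxy
    rw [wC_apply, wC_apply]
    by_cases h : ∀ i ∈ C, x i = topF j
    · rw [if_pos h, if_pos]
      intro i hi
      exact le_antisymm (le_topF _) ((h i hi) ▸ hxy i)
    · rw [if_neg h]; exact Fin.zero_le _

lemma sum_prod_pi {n j : ℕ} (g : Fin n → Fin j → ℝ) :
    ∑ x : Fin n → Fin j, ∏ i, g i (x i) = ∏ i, ∑ y, g i y := by
  rw [Finset.prod_univ_sum]
  simp

lemma Cfun_wC {n j k : ℕ} [NeZero j] [NeZero k] (hj : 2 ≤ j) (hk : 2 ≤ k)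
    (C T : Finset (Fin n)) :
    Cfun (wCgame C : (Fin n → Fin j) → Fin k) T =
      ((j : ℝ) ^ C.card)⁻¹ *
        ∑ R ∈ (C ∩ T).powerset, (((j : ℝ) - 1) ^ R.card - (-1) ^ R.card) := by
  have hj0 : (j : ℝ) ≠ 0 := by positivity
  have hk0 : (k : ℝ) - 1 ≠ 0 := by
    have : (2 : ℝ) ≤ k := by exact_mod_cast hk
    intro h; linarith
  have s1 : ∑ R ∈ (C ∩ T).powerset, ((j : ℝ) - 1) ^ R.card = (j : ℝ) ^ (C ∩ T).card := by
    have := Finset.sum_pow_mul_eq_add_pow ((j : ℝ) - 1) 1 (C ∩ T)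
    simpa using this
  have s2 : ∑ R ∈ (C ∩ T).powerset, (-1 : ℝ) ^ R.card = (0 : ℝ) ^ (C ∩ T).card := by
    have := Finset.sum_pow_mul_eq_add_pow (-1 : ℝ) 1 (C ∩ T)
    simpa using this
  rw [Finset.sum_sub_distrib, s1, s2]
  have gen : ∀ (c : Fin j) (r : ℝ), (∀ y : Fin j, y = y) →
      ((if c = topF j then (1 : ℝ) else 0) = r) →
      ∑ x : Fin n → Fin j, ((wCgame C (mer T c x) : Fin k).val : ℝ) =
      ((k : ℝ) - 1) * ((j : ℝ) ^ n * ((j : ℝ) ^ C.card)⁻¹ * ((j : ℝ) * r) ^ (C ∩ T).card) := by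
    intro c r _ hr
    have : ∀ x : Fin n → Fin j, ((wCgame C (mer T c x) : Fin k).val : ℝ) =
      ((k : ℝ) - 1) * ∏ i : Fin n, (fun i y => if i ∈ C → (if i ∈ T then c else y) = topF j then (1 : ℝ) else 0) i (x i) := by
      intro x
      rw [wC_val]; rfl
    rw [Finset.sum_congr rfl (fun x _ => this x), ← Finset.mul_sum,
      sum_prod_pi (fun i y => if i ∈ C → (if i ∈ T then c else y) = topF j then (1 : ℝ) else 0)]
    congr 1
    have e : ∀ i : Fin n, (∑ y : Fin j, if i ∈ C → (if i ∈ T then c else y) = topF j then (1 : ℝ) else 0)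
        = (j : ℝ) * (if i ∈ C then (j : ℝ)⁻¹ else 1) * (if i ∈ C ∩ T then (j : ℝ) * r else 1) := by
      intro i
      by_cases hC : i ∈ C
      · by_cases hT : i ∈ T
        · simp only [hC, hT, if_true, true_imp_iff, Finset.mem_inter, and_self, hr]
          simp
        · simp only [hC, hT, if_true, true_imp_iff, Finset.mem_inter, if_false, and_false]
          simp
      · simp [hC]
    rw [Finset.prod_congr rfl (fun i _ => e i)]
    simp only [Finset.prod_mul_distrib, Finset.prod_ite_mem, Finset.univ_inter, Finset.prod_const]
    simp [mul_pow]
  unfold Cfun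
  rw [Finset.sum_sub_distrib, gen (topF j) 1 (fun _ => rfl) (by simp),
    gen 0 0 (fun _ => rfl) (by rw [if_neg (topF_ne_zero hj).symm])]
  simp only [mul_one, mul_zero]
  field_simp

lemma Cfun_univ {n j k : ℕ} [NeZero j] [NeZero k] (hk : 2 ≤ k)
    (v : (Fin n → Fin j) → Fin k) (hv : IsJKGame v) : Cfun v univ = 1 := by
  have hj0 : (j : ℝ) ≠ 0 := by exact_mod_cast NeZero.ne j
  have hk0 : (k : ℝ) - 1 ≠ 0 := by
    have : (2 : ℝ) ≤ k := by exact_mod_cast hk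
    intro h; linarith
  have h : ∀ (c : Fin j) x, mer (univ : Finset (Fin n)) c x = fun _ => c := by
    intro c x; funext i; simp [mer]
  unfold Cfun
  simp only [h, hv.1, hv.2.1, topF_val]
  simp
  field_simp

lemma Cfun_empty {n j k : ℕ} [NeZero j] [NeZero k]
    (v : (Fin n → Fin j) → Fin k) : Cfun v ∅ = 0 := by
  have h : ∀ (c : Fin j) x, mer (∅ : Finset (Fin n)) c x = x := by
    intro c x; funext i; simp [mer]
  unfold Cfun
  simp [h]

/-- Every average game is a linear combination of the average games of the `w^C`. -/
lemma span_lemma {n j k : ℕ} [NeZero j] [NeZero k] (hj : 2 ≤ j) (hk : 2 ≤ k)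
    (v : (Fin n → Fin j) → Fin k) (hv : IsJKGame v) :
    ∃ c : Finset (Fin n) → ℝ, c ∅ = 0 ∧ ∀ T, Cfun v T =
      ∑ C, c C * Cfun (wCgame C : (Fin n → Fin j) → Fin k) T := by
  have hk0 : (k : ℝ) - 1 ≠ 0 := by
    have : (2 : ℝ) ≤ k := by exact_mod_cast hk
    intro h; linarith
  rcases Nat.lt_or_ge 2 j with h3 | h2
  · -- case j ≥ 3
    have hj0 : (j : ℝ) ≠ 0 := by positivity
    have hj3 : (3 : ℝ) ≤ j := by exact_mod_cast h3
    set d : Finset (Fin n) → ℝ := fun R => ((j : ℝ) - 1) ^ R.card - (-1) ^ R.card with hd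
    have hd0 : d ∅ = 0 := by simp [hd]
    have hdne : ∀ R : Finset (Fin n), R ≠ ∅ → d R ≠ 0 := by
      intro R hR
      have hc : R.card ≠ 0 := by simpa using hR
      have h1 : (1 : ℝ) < ((j : ℝ) - 1) ^ R.card := one_lt_pow₀ (by linarith) hc
      have h2 : (-1 : ℝ) ^ R.card ≤ 1 := by
        rcases neg_one_pow_eq_or ℝ R.card with h | h <;> rw [h] <;> norm_num
      simp only [hd]
      intro h; linarith
    obtain ⟨m, hm⟩ := exists_lower (Cfun v)
    have hm0 : m ∅ = 0 := by
      have := hm ∅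
      rw [Cfun_empty] at this
      simpa using this
    obtain ⟨e, he⟩ := exists_upper (fun R => m R / d R)
    refine ⟨fun C => if C = ∅ then 0 else (j : ℝ) ^ C.card * e C, by simp, fun T => ?_⟩
    have step : ∀ C : Finset (Fin n), (if C = ∅ then 0 else (j : ℝ) ^ C.card * e C) *
        Cfun (wCgame C : (Fin n → Fin j) → Fin k) T =
        ∑ R ∈ T.powerset, if R ⊆ C then e C * d R else 0 := by
      intro C
      rw [Cfun_wC hj hk, ← Finset.sum_filter, ← Finset.mul_sum]
      have hs : T.powerset.filter (fun R => R ⊆ C) = (C ∩ T).powerset := by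
        ext R
        simp only [Finset.mem_filter, Finset.mem_powerset, Finset.subset_inter_iff]
        tauto
      rw [hs]
      by_cases h : C = ∅
      · subst h
        simp [hd]
      · rw [if_neg h]
        field_simp
        simp only [hd]
    rw [Finset.sum_congr rfl (fun C _ => step C), Finset.sum_comm, ← hm T]
    refine Finset.sum_congr rfl fun R _ => ?_
    rw [← Finset.sum_filter, ← Finset.sum_mul, he R]
    by_cases hR : R = ∅
    · subst hR; rw [hm0, hd0]; simp
    · have := hdne R hR
      field_simp
  · have : j = 2 := le_antisymm h2 hj
    subst this
    obtain ⟨m, hm⟩ := exists_lower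
      (fun S => ((v (fun i => if i ∈ S then 1 else 0)).val : ℝ))
    have hm0 : m ∅ = 0 := by
      have := hm ∅
      simp [hv.1] at this
      exact this
    have hvx : ∀ x, ((v x).val : ℝ) = ∑ C, (m C / ((k : ℝ) - 1)) *
        ((wCgame C x : Fin k).val : ℝ) := by
      intro x
      have h1 := hm (univ.filter (fun i => x i = topF 2))
      have hx : (fun i => if i ∈ univ.filter (fun i => x i = topF 2) then (1 : Fin 2) else 0) = x := by
        funext i
        simp only [Finset.mem_filter, Finset.mem_univ, true_and]
        have ht : topF 2 = 1 := rfl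
        rw [ht]
        generalize x i = y
        fin_cases y <;> simp
      simp only [hx] at h1
      rw [← h1]
      have hp : (univ.filter (fun i => x i = topF 2)).powerset
          = univ.filter (fun C : Finset (Fin n) => ∀ i ∈ C, x i = topF 2) := by
        ext C
        simp [Finset.subset_iff]
      rw [hp, Finset.sum_filter]
      refine Finset.sum_congr rfl fun C _ => ?_
      rw [wC_apply]
      by_cases h : ∀ i ∈ C, x i = topF 2
      · rw [if_pos h, if_pos h, topF_val]; field_simp
      · rw [if_neg h, if_neg h]; simp
    refine ⟨fun C => m C / ((k : ℝ) - 1), by simp [hm0], fun T => ?_⟩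
    unfold Cfun
    simp only [hvx]
    simp only [← Finset.sum_sub_distrib, ← mul_sub]
    rw [Finset.sum_comm, Finset.mul_sum]
    refine Finset.sum_congr rfl fun C _ => ?_
    rw [← Finset.mul_sum]
    ring

def AxE {n j k : ℕ} [NeZero j] [NeZero k] (F : ((Fin n → Fin j) → Fin k) → Fin n → ℝ) : Prop :=
  ∀ v : (Fin n → Fin j) → Fin k, IsJKGame v → ∑ i : Fin n, F v i = 1

def AxS {n j k : ℕ} [NeZero j] [NeZero k] (F : ((Fin n → Fin j) → Fin k) → Fin n → ℝ) : Prop :=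
  ∀ v : (Fin n → Fin j) → Fin k, IsJKGame v →
        ∀ i h : Fin n, EquivPlayers v i h → F v i = F v h

def AxN {n j k : ℕ} [NeZero j] [NeZero k] (F : ((Fin n → Fin j) → Fin k) → Fin n → ℝ) : Prop :=
  ∀ v : (Fin n → Fin j) → Fin k, IsJKGame v →
        ∀ i : Fin n, NullPlayer v i → F v i = 0

def AxC {n j k : ℕ} [NeZero j] [NeZero k] (F : ((Fin n → Fin j) → Fin k) → Fin n → ℝ) : Prop :=
  ∀ (p q : ℕ) (α : Fin p → ℝ) (β : Fin q → ℝ)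
        (u : Fin p → (Fin n → Fin j) → Fin k) (w : Fin q → (Fin n → Fin j) → Fin k),
        (∀ t, IsJKGame (u t)) → (∀ t, IsJKGame (w t)) →
        (∀ t, 0 ≤ α t) → (∀ t, 0 ≤ β t) →
        (∑ t, α t = 1) → (∑ t, β t = 1) →
        (∀ S : Finset (Fin n), ∑ t, α t * Cfun (u t) S = ∑ t, β t * Cfun (w t) S) →
        ∀ i : Fin n, ∑ t, α t * F (u t) i = ∑ t, β t * F (w t) i

lemma F_wC {n j k : ℕ} [NeZero j] [NeZero k] (hj : 2 ≤ j)
    (F : ((Fin n → Fin j) → Fin k) → Fin n → ℝ) (hE : AxE F) (hS : AxS F) (hN : AxN F)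
    (C : Finset (Fin n)) (hC : C.Nonempty) (i : Fin n) :
    F (wCgame C) i = if i ∈ C then (C.card : ℝ)⁻¹ else 0 := by
  have hg := wC_game (k := k) hj C hC
  have hnull : ∀ i, i ∉ C → F (wCgame C) i = 0 := by
    intro i hi
    refine hN _ hg i fun x y => ?_
    rw [wC_apply, wC_apply]
    congr 1
    apply propext
    refine forall₂_congr fun l hl => ?_
    rw [Function.update_of_ne]
    rintro rfl; exact hi hl
  have hsym : ∀ i h, i ∈ C → h ∈ C → F (wCgame C) i = F (wCgame C) h := by
    intro i h hi hh
    refine hS _ hg i h fun x => ?_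
    rw [wC_apply, wC_apply]
    congr 1
    apply propext
    have hsw : ∀ l, l ∈ C → Equiv.swap i h l ∈ C := by
      intro l hl
      by_cases h1 : l = i
      · subst h1; simpa using hh
      · by_cases h2 : l = h
        · subst h2; simpa using hi
        · rwa [Equiv.swap_apply_of_ne_of_ne h1 h2]
    constructor
    · intro H l hl
      exact H _ (hsw l hl)
    · intro H l hl
      have := H _ (hsw l hl)
      simpa using this
  by_cases hi : i ∈ C
  · rw [if_pos hi]
    have h1 := hE _ hg
    rw [← Finset.sum_subset (Finset.subset_univ C) (fun l _ hl => hnull l hl),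
      Finset.sum_congr rfl (fun l hl => hsym l i hl hi)] at h1
    simp only [Finset.sum_const, nsmul_eq_mul] at h1
    exact eq_inv_of_mul_eq_one_right h1
  · rw [if_neg hi, hnull i hi]

lemma AxC_gen {n j k : ℕ} [NeZero j] [NeZero k]
    (F : ((Fin n → Fin j) → Fin k) → Fin n → ℝ) (hF : AxC F)
    {ι κ : Type} [Fintype ι] [Fintype κ] (α : ι → ℝ) (β : κ → ℝ)
    (u : ι → (Fin n → Fin j) → Fin k) (w : κ → (Fin n → Fin j) → Fin k)
    (hu : ∀ t, IsJKGame (u t)) (hw : ∀ t, IsJKGame (w t))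
    (hα : ∀ t, 0 ≤ α t) (hβ : ∀ t, 0 ≤ β t) (sα : ∑ t, α t = 1) (sβ : ∑ t, β t = 1)
    (h : ∀ S : Finset (Fin n), ∑ t, α t * Cfun (u t) S = ∑ t, β t * Cfun (w t) S) (i : Fin n) :
    ∑ t, α t * F (u t) i = ∑ t, β t * F (w t) i := by
  let e := (Fintype.equivFin ι).symm
  let e' := (Fintype.equivFin κ).symm
  have := hF _ _ (α ∘ e) (β ∘ e') (u ∘ e) (w ∘ e') (fun t => hu _) (fun t => hw _)
    (fun t => hα _) (fun t => hβ _)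
    ((Equiv.sum_comp e α).trans sα) ((Equiv.sum_comp e' β).trans sβ)
    (fun S => ((Equiv.sum_comp e (fun t => α t * Cfun (u t) S)).trans (h S)).trans
      (Equiv.sum_comp e' (fun t => β t * Cfun (w t) S)).symm) i
  exact ((Equiv.sum_comp e (fun t => α t * F (u t) i)).symm.trans this).trans
      (Equiv.sum_comp e' (fun t => β t * F (w t) i))

/-- Average convexity implies the linear-combination formula. -/
lemma F_eq {n j k : ℕ} [NeZero j] [NeZero k] (hj : 2 ≤ j) (hk : 2 ≤ k)
    (F : ((Fin n → Fin j) → Fin k) → Fin n → ℝ) (hF : AxC F)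
    (v : (Fin n → Fin j) → Fin k) (hv : IsJKGame v)
    (c : {C : Finset (Fin n) // C.Nonempty} → ℝ)
    (hc : ∀ T, Cfun v T = ∑ C, c C * Cfun (wCgame C.1 : (Fin n → Fin j) → Fin k) T)
    (i : Fin n) : F v i = ∑ C, c C * F (wCgame C.1) i := by
  have hsum : ∑ C, c C = 1 := by
    have := hc univ
    rw [Cfun_univ hk v hv] at this
    rw [this]
    refine Finset.sum_congr rfl fun C _ => ?_
    rw [Cfun_univ hk _ (wC_game hj C.1 C.2), mul_one]
  set M : ℝ := 1 + ∑ C, (c C)⁻ with hM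
  have hpm : ∀ C, c C = (c C)⁺ - (c C)⁻ := fun C => (posPart_sub_negPart _).symm
  have hMp : M = ∑ C, (c C)⁺ := by
    rw [hM, ← hsum, ← Finset.sum_add_distrib]
    refine Finset.sum_congr rfl fun C _ => ?_
    linarith [hpm C]
  have hMpos : 0 < M := by
    have : 0 ≤ ∑ C, (c C)⁻ := Finset.sum_nonneg fun C _ => negPart_nonneg _
    linarith
  have key := AxC_gen F hF
    (ι := Option {C : Finset (Fin n) // C.Nonempty}) (κ := {C : Finset (Fin n) // C.Nonempty})
    (fun o => (o.elim 1 (fun C => (c C)⁻)) / M) (fun C => (c C)⁺ / M)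
    (fun o => o.elim v (fun C => wCgame C.1)) (fun C => wCgame C.1)
    (by rintro (_ | C)
        · exact hv
        · exact wC_game hj C.1 C.2)
    (fun C => wC_game hj C.1 C.2)
    (by rintro (_ | C)
        · exact div_nonneg zero_le_one hMpos.le
        · exact div_nonneg (negPart_nonneg _) hMpos.le)
    (fun C => div_nonneg (posPart_nonneg _) hMpos.le)
    (by rw [← Finset.sum_div, Fintype.sum_option]
        exact div_self hMpos.ne')
    (by rw [← Finset.sum_div, ← hMp]
        exact div_self hMpos.ne')
    (by intro S
        simp only [div_mul_eq_mul_div]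
        rw [← Finset.sum_div, ← Finset.sum_div, Fintype.sum_option]
        congr 1
        simp only [Option.elim]
        rw [hc S, one_mul, ← Finset.sum_add_distrib]
        refine Finset.sum_congr rfl fun C _ => ?_
        rw [← add_mul]
        congr 1
        linarith [hpm C]) i
  simp only [div_mul_eq_mul_div] at key
  rw [← Finset.sum_div, ← Finset.sum_div, Fintype.sum_option, div_left_inj' hMpos.ne'] at key
  simp only [Option.elim, one_mul] at key
  rw [eq_sub_of_add_eq key, ← Finset.sum_sub_distrib]
  refine Finset.sum_congr rfl fun C _ => ?_
  rw [← sub_mul, ← hpm C]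

lemma uniq {n j k : ℕ} [NeZero j] [NeZero k] (hj : 2 ≤ j) (hk : 2 ≤ k)
    (F G : ((Fin n → Fin j) → Fin k) → Fin n → ℝ)
    (hE : AxE F) (hS : AxS F) (hN : AxN F) (hC : AxC F)
    (hE' : AxE G) (hS' : AxS G) (hN' : AxN G) (hC' : AxC G)
    (v : (Fin n → Fin j) → Fin k) (hv : IsJKGame v) : F v = G v := by
  obtain ⟨c, hc0, hc⟩ := span_lemma hj hk v hv
  have hc2 : ∀ T, Cfun v T = ∑ C : {C : Finset (Fin n) // C.Nonempty},
      c C.1 * Cfun (wCgame C.1 : (Fin n → Fin j) → Fin k) T := by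
    intro T
    rw [hc T]
    have h1 := Finset.sum_subtype (univ.filter (fun C : Finset (Fin n) => C.Nonempty))
      (p := fun C : Finset (Fin n) => C.Nonempty) (F := inferInstance) (by simp)
      (fun C => c C * Cfun (wCgame C : (Fin n → Fin j) → Fin k) T)
    refine Eq.trans ?_ (h1.trans (by congr!))
    symm
    refine Finset.sum_subset (Finset.subset_univ _) fun C _ hC => ?_
    have : C = ∅ := by simpa using hC
    rw [this, hc0, zero_mul]
  funext i
  rw [F_eq hj hk F hC v hv (fun C => c C.1) hc2 i, F_eq hj hk G hC' v hv (fun C => c C.1) hc2 i]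
  refine Finset.sum_congr rfl fun C _ => ?_
  rw [F_wC hj F hE hS hN C.1 C.2, F_wC hj G hE' hS' hN' C.1 C.2]

lemma Phi_C {n j k : ℕ} [NeZero j] [NeZero k] :
    AxC (Phi : ((Fin n → Fin j) → Fin k) → Fin n → ℝ) := by
  intro p q α β u w _ _ _ _ _ _ h i
  have gen : ∀ (p : ℕ) (α : Fin p → ℝ) (u : Fin p → (Fin n → Fin j) → Fin k),
      ∑ t, α t * Phi (u t) i = ∑ S ∈ univ.filter (fun S : Finset (Fin n) => i ∈ S),
    ((Nat.factorial (S.card - 1) * Nat.factorial (n - S.card) : ℝ) / (Nat.factorial n : ℝ)) *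
      (∑ t, α t * Cfun (u t) S - ∑ t, α t * Cfun (u t) (S.erase i)) := by
    intro p α u
    unfold Phi
    simp only [Finset.mul_sum]
    rw [Finset.sum_comm]
    refine Finset.sum_congr rfl fun S _ => ?_
    rw [← Finset.sum_sub_distrib, Finset.mul_sum]
    refine Finset.sum_congr rfl fun t _ => ?_
    ring
  rw [gen, gen]
  simp only [h]

lemma Phi_N {n j k : ℕ} [NeZero j] [NeZero k] :
    AxN (Phi : ((Fin n → Fin j) → Fin k) → Fin n → ℝ) := by
  intro v _ i hi
  unfold Phi
  refine Finset.sum_eq_zero fun S hS => ?_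
  have hiS : i ∈ S := (Finset.mem_filter.1 hS).2
  have hm : ∀ (c : Fin j) x, v (mer S c x) = v (mer (S.erase i) c x) := by
    intro c x
    rw [hi (mer (S.erase i) c x) c]
    congr 1
    funext l
    by_cases hl : l = i
    · subst hl; simp [mer, hiS]
    · simp [mer, hl, Function.update_of_ne]
  have : Cfun v S = Cfun v (S.erase i) := by
    unfold Cfun
    simp only [hm]
  rw [this, sub_self, mul_zero]

lemma Phi_S {n j k : ℕ} [NeZero j] [NeZero k] :
    AxS (Phi : ((Fin n → Fin j) → Fin k) → Fin n → ℝ) := by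
  intro v _ i h hih
  have hC : ∀ S : Finset (Fin n), Cfun v (S.map (Equiv.swap i h).toEmbedding) = Cfun v S := by
    intro S
    unfold Cfun
    congr 1
    have hm : ∀ (c : Fin j) (x : Fin n → Fin j),
        v (mer (S.map (Equiv.swap i h).toEmbedding) c (x ∘ Equiv.swap i h)) = v (mer S c x) := by
      intro c x
      rw [hih (mer S c x)]
      congr 1
      funext l
      have : l ∈ S.map (Equiv.swap i h).toEmbedding ↔ Equiv.swap i h l ∈ S := by
        rw [Finset.mem_map_equiv, Equiv.symm_swap]
      simp only [mer, this, Function.comp]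
    rw [← Equiv.sum_comp (Equiv.arrowCongr (Equiv.swap i h) (Equiv.refl (Fin j)))]
    refine Finset.sum_congr rfl fun x _ => ?_
    have hx : (Equiv.arrowCongr (Equiv.swap i h) (Equiv.refl (Fin j))) x = x ∘ Equiv.swap i h := by
      funext l; simp [Equiv.arrowCongr]
    rw [hx, hm, hm]
  have hinv : ∀ S : Finset (Fin n), (S.map (Equiv.swap i h).toEmbedding).map (Equiv.swap i h).toEmbedding = S := by
    intro S
    ext l
    simp only [Finset.mem_map_equiv, Equiv.symm_swap, Equiv.swap_apply_self]
    
  unfold Phi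
  refine Finset.sum_nbij' (fun S => S.map (Equiv.swap i h).toEmbedding)
    (fun S => S.map (Equiv.swap i h).toEmbedding) ?_ ?_ (fun S _ => hinv S) (fun S _ => hinv S) ?_
  · intro S hS
    simp only [Finset.mem_filter, Finset.mem_univ, true_and, Finset.mem_map_equiv, Equiv.symm_swap, Equiv.swap_apply_right] at hS ⊢
    exact hS
  · intro S hS
    simp only [Finset.mem_filter, Finset.mem_univ, true_and, Finset.mem_map_equiv, Equiv.symm_swap, Equiv.swap_apply_left] at hS ⊢
    exact hS
  · intro S hS
    have he : (S.map (Equiv.swap i h).toEmbedding).erase h = (S.erase i).map (Equiv.swap i h).toEmbedding := by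
      ext l
      simp only [Finset.mem_erase, Finset.mem_map_equiv, Equiv.symm_swap, ne_eq, Equiv.swap_apply_eq_iff, Equiv.swap_apply_left]
    rw [he, hC, hC, Finset.card_map]

lemma Phi_E {n j k : ℕ} [NeZero j] [NeZero k] (hk : 2 ≤ k) :
    AxE (Phi : ((Fin n → Fin j) → Fin k) → Fin n → ℝ) := by
  intro v hv
  have hn : n ≠ 0 := by
    rintro rfl
    have h1 := hv.1
    have h2 := hv.2.1
    rw [show (fun _ : Fin 0 => topF j) = fun _ => 0 from funext fun i => i.elim0, h1] at h2
    exact topF_ne_zero hk h2.symm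
  set f := Cfun v with hf
  let w : ℕ → ℝ := fun s =>
    ((Nat.factorial (s - 1) * Nat.factorial (n - s) : ℝ) / (Nat.factorial n : ℝ))
  have hA : ∑ i : Fin n, ∑ S ∈ univ.filter (fun S : Finset (Fin n) => i ∈ S), w S.card * f S
      = ∑ S : Finset (Fin n), (S.card : ℝ) * w S.card * f S := by
    simp only [Finset.sum_filter]
    rw [Finset.sum_comm]
    refine Finset.sum_congr rfl fun S _ => ?_
    rw [← Finset.sum_filter]
    simp [mul_assoc]
  have hB : ∑ i : Fin n, ∑ S ∈ univ.filter (fun S : Finset (Fin n) => i ∈ S), w S.card * f (S.erase i)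
      = ∑ S : Finset (Fin n), ((n : ℝ) - S.card) * w (S.card + 1) * f S := by
    have h1 : ∀ i : Fin n, ∑ S ∈ univ.filter (fun S : Finset (Fin n) => i ∈ S), w S.card * f (S.erase i)
        = ∑ S ∈ univ.filter (fun S : Finset (Fin n) => i ∉ S), w (S.card + 1) * f S := by
      intro i
      refine Finset.sum_nbij' (fun S => S.erase i) (fun S => insert i S) ?_ ?_ ?_ ?_ ?_
      · intro S _; simp
      · intro S _; simp
      · intro S hS
        exact Finset.insert_erase (Finset.mem_filter.1 hS).2
      · intro S hS
        exact Finset.erase_insert (Finset.mem_filter.1 hS).2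
      · intro S hS
        rw [Finset.card_erase_add_one (Finset.mem_filter.1 hS).2]
    simp only [h1, Finset.sum_filter]
    rw [Finset.sum_comm]
    refine Finset.sum_congr rfl fun S _ => ?_
    rw [← Finset.sum_filter]
    have : (univ.filter (fun i => i ∉ S)) = Sᶜ := by ext l; simp
    rw [this, Finset.sum_const, Finset.card_compl, nsmul_eq_mul, Fintype.card_fin,
      Nat.cast_sub (by simpa using Finset.card_le_univ S)]
    ring
  have hsplit : ∑ i : Fin n, Phi v i = ∑ S : Finset (Fin n),
      ((S.card : ℝ) * w S.card - ((n : ℝ) - S.card) * w (S.card + 1)) * f S := by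
    simp only [sub_mul]
    rw [Finset.sum_sub_distrib]
    simp only [sub_mul] at hB
    rw [← hA, ← hB, ← Finset.sum_sub_distrib]
    refine Finset.sum_congr rfl fun i _ => ?_
    rw [← Finset.sum_sub_distrib]
    unfold Phi
    refine Finset.sum_congr rfl fun S _ => ?_
    rw [mul_sub]
  have hco : ∀ S : Finset (Fin n),
      ((S.card : ℝ) * w S.card - ((n : ℝ) - S.card) * w (S.card + 1)) * f S =
      if S = univ then 1 else 0 := by
    intro S
    have hnf : (Nat.factorial n : ℝ) ≠ 0 := by exact_mod_cast Nat.factorial_ne_zero n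
    have hle : S.card ≤ n := by simpa using Finset.card_le_univ S
    by_cases h0 : S = ∅
    · subst h0
      have : (∅ : Finset (Fin n)) ≠ univ := by
        intro h
        have := congrArg Finset.card h
        simp at this
        exact hn this.symm
      rw [if_neg this, hf, Cfun_empty, mul_zero]
    have hs0 : S.card ≠ 0 := by simpa using h0
    have e1 : (S.card : ℝ) * w S.card = (Nat.factorial S.card * Nat.factorial (n - S.card) : ℝ) / Nat.factorial n := by
      have := Nat.mul_factorial_pred hs0
      simp only [w]
      rw [← this]
      push_cast
      ring
    by_cases hu : S = univ
    · subst hu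
      rw [if_pos rfl, hf, Cfun_univ hk v hv, e1]
      simp [hnf]
    · rw [if_neg hu, e1]
      have hlt : S.card < n := by
        have := (Finset.card_lt_univ_of_notMem (s := S) (x := (Classical.not_forall.1 (fun h => hu (Finset.eq_univ_iff_forall.2 h))).choose) (Classical.not_forall.1 (fun h => hu (Finset.eq_univ_iff_forall.2 h))).choose_spec)
        simpa using this
      have e2 : ((n : ℝ) - S.card) * w (S.card + 1) = (Nat.factorial S.card * Nat.factorial (n - S.card) : ℝ) / Nat.factorial n := by
        have := Nat.mul_factorial_pred (n := n - S.card) (by omega)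
        simp only [w]
        rw [← this, Nat.add_sub_cancel, Nat.sub_sub]
        push_cast
        rw [Nat.cast_sub hle]
        ring
      rw [e2]; ring
  rw [hsplit, Finset.sum_congr rfl (fun S _ => hco S)]
  simp

end helpers

theorem stmt18 {n j k : ℕ} [NeZero j] [NeZero k] (hj : 2 ≤ j) (hk : 2 ≤ k)
    (F : ((Fin n → Fin j) → Fin k) → Fin n → ℝ) :
    ((∀ v : (Fin n → Fin j) → Fin k, IsJKGame v → ∑ i : Fin n, F v i = 1) ∧
     (∀ v : (Fin n → Fin j) → Fin k, IsJKGame v →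
        ∀ i h : Fin n, EquivPlayers v i h → F v i = F v h) ∧
     (∀ v : (Fin n → Fin j) → Fin k, IsJKGame v →
        ∀ i : Fin n, NullPlayer v i → F v i = 0) ∧
     (∀ (p q : ℕ) (α : Fin p → ℝ) (β : Fin q → ℝ)
        (u : Fin p → (Fin n → Fin j) → Fin k) (w : Fin q → (Fin n → Fin j) → Fin k),
        (∀ t, IsJKGame (u t)) → (∀ t, IsJKGame (w t)) →
        (∀ t, 0 ≤ α t) → (∀ t, 0 ≤ β t) →
        (∑ t, α t = 1) → (∑ t, β t = 1) →
        (∀ S : Finset (Fin n), ∑ t, α t * Cfun (u t) S = ∑ t, β t * Cfun (w t) S) →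
        ∀ i : Fin n, ∑ t, α t * F (u t) i = ∑ t, β t * F (w t) i)) ↔
      (∀ v : (Fin n → Fin j) → Fin k, IsJKGame v → F v = Phi v) := by
  constructor
  · rintro ⟨hE, hS, hN, hC⟩ v hv
    exact uniq hj hk F Phi hE hS hN hC (Phi_E hk) Phi_S Phi_N Phi_C v hv
  · intro H
    refine ⟨?_, ?_, ?_, ?_⟩
    · intro v hv
      rw [H v hv]; exact Phi_E hk v hv
    · intro v hv
      rw [H v hv]; exact Phi_S v hv
    · intro v hv
      rw [H v hv]; exact Phi_N v hv
    · intro p q α β u w hu hw h1 h2 h3 h4 h5 i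
      have := Phi_C p q α β u w hu hw h1 h2 h3 h4 h5 i
      simp only [H _ (hu _), H _ (hw _)]
      exact this
end
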